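/- arXiv:1612.09250 — 3 statements merged into one kernel-verified Lean document; each statement's English description precedes it below -/
import Mathlib

section
/- For any N ∈ ℕ, any Hamiltonian H : Σ_N → ℝ, any n, m ≥ 1, any p ≥ 2, any i ∈ {1,…,N}^p and any F : Σ_N^n → [−1,1], one has ⟨D_i^m F⟩_H = Σ_{a=1}^∞ A(m,a) ⟨S_i^{m−2a+2,n} F⟩_H, where the sum has only finitely many nonzero terms. -/
open Filter

noncomputable section

/-- The configuration space `Σ_N = {-1,1}^N`, encoded by booleans. -/
abbrev Spin (N : ℕ) := Fin N → Bool

/-- The real spin value `σ_i ∈ {-1,1}` at site `i`. -/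
def spin {N : ℕ} (σ : Spin N) (i : Fin N) : ℝ := if σ i then 1 else -1

/-- For `i = (i₁,…,i_p)`, the product `σ_i = σ_{i₁} ⋯ σ_{i_p}`. -/
def spinProd {N p : ℕ} (σ : Spin N) (i : Fin p → Fin N) : ℝ := ∏ j, spin σ (i j)

/-- The partition function `Z(H)`. -/
def partitionZ {N : ℕ} (H : Spin N → ℝ) : ℝ := ∑ τ : Spin N, Real.exp (H τ)

/-- The Gibbs measure `G_H({σ}) = e^{H(σ)}/Z(H)`. -/
def gibbs {N : ℕ} (H : Spin N → ℝ) (σ : Spin N) : ℝ := Real.exp (H σ) / partitionZ H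

/-- The Gibbs expectation `⟨F⟩_H` of a function of `n` replicas. -/
def gibbsExp {N n : ℕ} (H : Spin N → ℝ) (F : (Fin n → Spin N) → ℝ) : ℝ :=
  ∑ σ : Fin n → Spin N, F σ * ∏ ℓ, gibbs H (σ ℓ)

/-- The multiplication operator `D_i` of (2.1):
`D_i F(σ¹,…,σ^{n+1}) = (∑_{ℓ=1}^n σ_i^ℓ - n σ_i^{n+1}) F(σ¹,…,σⁿ)`. -/
def Dop {N p : ℕ} (i : Fin p → Fin N) {n : ℕ} (F : (Fin n → Spin N) → ℝ)
    (σ : Fin (n + 1) → Spin N) : ℝ :=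
  ((∑ ℓ : Fin n, spinProd (σ ℓ.castSucc) i) - n * spinProd (σ (Fin.last n)) i) *
    F fun ℓ => σ ℓ.castSucc

/-- The `m`-fold iterate `D_i^m F`, a function of `n + m` replicas. -/
def DopIter {N p : ℕ} (i : Fin p → Fin N) {n : ℕ} :
    (m : ℕ) → ((Fin n → Spin N) → ℝ) → (Fin (n + m) → Spin N) → ℝ
  | 0, F => F
  | m + 1, F => Dop i (DopIter i m F)

/-- Extension of a finite replica family to an infinite one (junk beyond index `r`). -/
def extendReplicas {N r : ℕ} (σ : Fin r → Spin N) : ℕ → Spin N :=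
  fun j => if hj : j < r then σ ⟨j, hj⟩ else fun _ => true

/-- The functions `S_i^{m,n}` of (4.1), for an integer superscript `m` (zero if `m ≤ 0`):
`S_i^{m,n} = m! ∑_{k=0}^m (-1)^{m-k} C(n+m-k-1, n-1)
  ∑_{1≤ℓ₁<⋯<ℓ_k≤n} σ_i^{ℓ₁}⋯σ_i^{ℓ_k} σ_i^{n+1}⋯σ_i^{n+m-k}`. -/
def Sfun {N p : ℕ} (i : Fin p → Fin N) (n : ℕ) (m : ℤ) (σ : ℕ → Spin N) : ℝ :=
  if 1 ≤ m then
    (Nat.factorial m.toNat : ℝ) * ∑ k ∈ Finset.range (m.toNat + 1),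
      (-1 : ℝ) ^ (m.toNat - k) * (Nat.choose (n + m.toNat - k - 1) (n - 1) : ℝ) *
        ∑ T ∈ Finset.powersetCard k (Finset.univ : Finset (Fin n)),
          (∏ ℓ ∈ T, spinProd (σ (ℓ : ℕ)) i) *
            ∏ j ∈ Finset.Ico n (n + m.toNat - k), spinProd (σ j) i
  else 0

/-- The integer array `A(m,a)` defined recursively by `A(m,0) = 0`, `A(1,a) = 1_{a=1}` and
`A(m+1,a) = -(m-2a+4)(m-2a+3) A(m,a-1) + A(m,a)` for `m, a ≥ 1`. -/
def Aarr : ℕ → ℕ → ℤ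
  | _, 0 => 0
  | 0, _ + 1 => 0
  | 1, a + 1 => if a = 0 then 1 else 0
  | m + 2, a + 1 =>
      -(((m : ℤ) + 1) - 2 * ((a : ℤ) + 1) + 4) * (((m : ℤ) + 1) - 2 * ((a : ℤ) + 1) + 3)
          * Aarr (m + 1) a + Aarr (m + 1) (a + 1)

open PowerSeries in
/-- The power series whose coefficients are, as functions of replicas, the elementary symmetric
polynomials in the spin products, averaged against `F`. -/
def esymmSeries {N p n : ℕ} (i : Fin p → Fin N) (F : (Fin n → Spin N) → ℝ) (H : Spin N → ℝ) :
    PowerSeries ℝ :=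
  ∑ σ : Fin n → Spin N, C (F σ * ∏ ℓ, gibbs H (σ ℓ)) * ∏ ℓ, (1 + C (spinProd (σ ℓ) i) * X)

/-- The Gibbs mean of `σ_i` under one replica. -/
def gibbsMean {N p : ℕ} (i : Fin p → Fin N) (H : Spin N → ℝ) : ℝ :=
  ∑ τ, gibbs H τ * spinProd τ i

/-- The series `⟨F ∏ (1 + σ_i^ℓ X)⟩ (1 + ⟨σ_i⟩ X)⁻ⁿ`. -/
def replicaSeries {N p n : ℕ} (i : Fin p → Fin N) (F : (Fin n → Spin N) → ℝ) (H : Spin N → ℝ) :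
    PowerSeries ℝ :=
  esymmSeries i F H * PowerSeries.rescale (-gibbsMean i H) (PowerSeries.mk 1 ^ n)

/-- The Hamiltonian `H` tilted by `t σ_i`. -/
def tilt {N p : ℕ} (i : Fin p → Fin N) (H : Spin N → ℝ) (t : ℝ) : Spin N → ℝ :=
  fun σ => H σ + t * spinProd σ i

section Gibbs

variable {N p n : ℕ} (i : Fin p → Fin N) (H : Spin N → ℝ)

theorem spinProd_mul_self (σ : Spin N) : spinProd σ i * spinProd σ i = 1 := by
  rw [spinProd, ← Finset.prod_mul_distrib]
  refine Finset.prod_eq_one fun j _ => ?_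
  unfold spin
  split_ifs <;> norm_num

theorem partitionZ_pos : 0 < partitionZ H :=
  Finset.sum_pos (fun _ _ => Real.exp_pos _) Finset.univ_nonempty

theorem sum_gibbs : ∑ τ, gibbs H τ = 1 := by
  simp only [gibbs, ← Finset.sum_div]
  exact div_self (partitionZ_pos H).ne'

theorem gibbsExp_sum {ι : Type*} (s : Finset ι) (K : ι → (Fin n → Spin N) → ℝ) :
    gibbsExp H (fun σ => ∑ j ∈ s, K j σ) = ∑ j ∈ s, gibbsExp H (K j) := by
  simp only [gibbsExp, Finset.sum_mul]
  exact Finset.sum_comm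

theorem gibbsExp_const_mul (c : ℝ) (K : (Fin n → Spin N) → ℝ) :
    gibbsExp H (fun σ => c * K σ) = c * gibbsExp H K := by
  simp only [gibbsExp, Finset.mul_sum, mul_assoc]

theorem gibbsExp_succ (K : (Fin (n + 1) → Spin N) → ℝ) :
    gibbsExp H K = ∑ τ, gibbs H τ *
      gibbsExp H fun σ : Fin n → Spin N => K (Fin.snoc (α := fun _ => Spin N) σ τ) := by
  rw [gibbsExp, ← (Fin.snocEquiv fun _ : Fin (n + 1) => Spin N).sum_comp, Fintype.sum_prod_type]
  refine Finset.sum_congr rfl fun τ _ => ?_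
  rw [gibbsExp, Finset.mul_sum]
  refine Finset.sum_congr rfl fun σ _ => ?_
  simp only [Fin.snocEquiv, Equiv.coe_fn_mk, Fin.prod_univ_castSucc, Fin.snoc_castSucc,
    Fin.snoc_last]
  ring

theorem gibbsExp_Dop (K : (Fin n → Spin N) → ℝ) :
    gibbsExp H (Dop i K) =
      gibbsExp H fun σ => ((∑ ℓ, spinProd (σ ℓ) i) - n * gibbsMean i H) * K σ := by
  rw [gibbsExp_succ]
  simp only [Dop, Fin.snoc_castSucc, Fin.snoc_last, gibbsExp, gibbsMean, Finset.mul_sum]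
  rw [Finset.sum_comm]
  refine Finset.sum_congr rfl fun σ _ => ?_
  calc _ = ((∑ ℓ, spinProd (σ ℓ) i) * ∑ τ, gibbs H τ - ∑ τ, n * (gibbs H τ * spinProd τ i))
          * K σ * ∏ ℓ, gibbs H (σ ℓ) := by
        rw [Finset.mul_sum, ← Finset.sum_sub_distrib, Finset.sum_mul, Finset.sum_mul]
        exact Finset.sum_congr rfl fun τ _ => by ring
    _ = _ := by rw [sum_gibbs, mul_one]

theorem extendReplicas_snoc_of_lt {r : ℕ} (σ : Fin r → Spin N) (τ : Spin N) {j : ℕ} (hj : j < r) :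
    extendReplicas (Fin.snoc (α := fun _ => Spin N) σ τ) j = extendReplicas σ j := by
  simp only [extendReplicas, hj, hj.trans (Nat.lt_succ_self r), dif_pos]
  exact Fin.snoc_castSucc (α := fun _ => Spin N) τ σ ⟨j, hj⟩

theorem extendReplicas_snoc_self {r : ℕ} (σ : Fin r → Spin N) (τ : Spin N) :
    extendReplicas (Fin.snoc (α := fun _ => Spin N) σ τ) r = τ := by
  simp only [extendReplicas, Nat.lt_succ_self, dif_pos]
  exact Fin.snoc_last (α := fun _ => Spin N) τ σ

/-- Integrating out fresh replicas. -/
theorem gibbsExp_mul_prod_Ico (K : (Fin n → Spin N) → ℝ) (m r : ℕ) (hr : r ≤ m) :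
    gibbsExp H (fun σ : Fin (n + m) → Spin N => K (fun ℓ => σ (ℓ.castAdd m)) *
      ∏ j ∈ Finset.Ico n (n + r), spinProd (extendReplicas σ j) i)
      = gibbsMean i H ^ r * gibbsExp H K := by
  induction m generalizing r with
  | zero =>
    obtain rfl : r = 0 := by omega
    simp
  | succ m ih =>
    have hK : ∀ (σ : Fin (n + m) → Spin N) (τ : Spin N),
        (fun ℓ : Fin n => Fin.snoc (α := fun _ => Spin N) σ τ (ℓ.castAdd (m + 1))) =
          fun ℓ => σ (ℓ.castAdd m) := fun σ τ => funext fun ℓ =>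
      Fin.snoc_castSucc (α := fun _ => Spin N) τ σ (ℓ.castAdd m)
    refine (gibbsExp_succ (n := n + m) H _).trans ?_
    simp only [hK]
    have hprod : ∀ (σ : Fin (n + m) → Spin N) (τ : Spin N) (k : ℕ), k ≤ m →
        ∏ j ∈ Finset.Ico n (n + k),
          spinProd (extendReplicas (Fin.snoc (α := fun _ => Spin N) σ τ) j) i =
        ∏ j ∈ Finset.Ico n (n + k), spinProd (extendReplicas σ j) i := fun σ τ k hk =>
      Finset.prod_congr rfl fun j hj => by
        rw [extendReplicas_snoc_of_lt _ _ (by have := Finset.mem_Ico.1 hj; omega)]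
    rcases hr.lt_or_eq with h | rfl
    · have h' : r ≤ m := by omega
      simp only [fun σ τ => hprod σ τ r h', ih r h', ← Finset.sum_mul, sum_gibbs, one_mul]
    · have hlast : ∀ (σ : Fin (n + m) → Spin N) (τ : Spin N),
          K (fun ℓ => σ (ℓ.castAdd m)) * ∏ j ∈ Finset.Ico n (n + (m + 1)),
            spinProd (extendReplicas (Fin.snoc (α := fun _ => Spin N) σ τ) j) i =
          spinProd τ i * (K (fun ℓ => σ (ℓ.castAdd m)) *
            ∏ j ∈ Finset.Ico n (n + m), spinProd (extendReplicas σ j) i) := fun σ τ => by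
        rw [← Nat.add_assoc, Finset.prod_Ico_succ_top (by omega), hprod σ τ m le_rfl,
          extendReplicas_snoc_self]
        ring
      simp only [hlast, gibbsExp_const_mul, ih m le_rfl]
      simp only [← mul_assoc, ← Finset.sum_mul]
      rw [pow_succ', ← gibbsMean]

end Gibbs

section Tilt

variable {N p n : ℕ} (i : Fin p → Fin N) (H : Spin N → ℝ)

theorem hasDerivAt_gibbs_tilt (σ : Spin N) (t : ℝ) :
    HasDerivAt (fun t => gibbs (tilt i H t) σ)
      (gibbs (tilt i H t) σ * (spinProd σ i - gibbsMean i (tilt i H t))) t := by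
  have hexp : ∀ τ : Spin N, HasDerivAt (fun t => Real.exp (tilt i H t τ))
      (Real.exp (tilt i H t τ) * spinProd τ i) t := fun τ =>
    ((((hasDerivAt_id t).mul_const (spinProd τ i)).const_add (H τ)).exp).congr_deriv (by
      simp [tilt])
  have hZ : HasDerivAt (fun t => partitionZ (tilt i H t))
      (∑ τ, Real.exp (tilt i H t τ) * spinProd τ i) t :=
    HasDerivAt.fun_sum fun τ _ => hexp τ
  have hne := (partitionZ_pos (tilt i H t)).ne'
  refine ((hexp σ).div hZ hne).congr_deriv ?_
  have hmean : gibbsMean i (tilt i H t) =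
      (∑ τ, Real.exp (tilt i H t τ) * spinProd τ i) / partitionZ (tilt i H t) := by
    simp only [gibbsMean, gibbs, Finset.sum_div]
    exact Finset.sum_congr rfl fun τ _ => by ring
  rw [hmean, gibbs]
  field_simp

theorem hasDerivAt_gibbsMean_tilt (t : ℝ) :
    HasDerivAt (fun t => gibbsMean i (tilt i H t)) (1 - gibbsMean i (tilt i H t) ^ 2) t := by
  refine (HasDerivAt.fun_sum fun τ _ =>
    (hasDerivAt_gibbs_tilt i H τ t).mul_const (spinProd τ i)).congr_deriv ?_
  calc _ = ∑ τ, gibbs (tilt i H t) τ - gibbsMean i (tilt i H t) * gibbsMean i (tilt i H t) := by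
        conv_rhs => rw [gibbsMean, Finset.mul_sum, ← Finset.sum_sub_distrib]
        refine Finset.sum_congr rfl fun τ _ => ?_
        rw [← gibbsMean]
        linear_combination gibbs (tilt i H t) τ * spinProd_mul_self i τ
    _ = _ := by rw [sum_gibbs]; ring

theorem hasDerivAt_prod_gibbs_tilt (σ : Fin n → Spin N) (t : ℝ) :
    HasDerivAt (fun t => ∏ ℓ, gibbs (tilt i H t) (σ ℓ))
      (((∑ ℓ, spinProd (σ ℓ) i) - n * gibbsMean i (tilt i H t)) *
        ∏ ℓ, gibbs (tilt i H t) (σ ℓ)) t := by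
  refine (HasDerivAt.fun_finsetProd fun ℓ _ =>
    hasDerivAt_gibbs_tilt i H (σ ℓ) t).congr_deriv ?_
  have h : ∀ ℓ, (∏ j ∈ Finset.univ.erase ℓ, gibbs (tilt i H t) (σ j)) •
      (gibbs (tilt i H t) (σ ℓ) * (spinProd (σ ℓ) i - gibbsMean i (tilt i H t))) =
      (spinProd (σ ℓ) i - gibbsMean i (tilt i H t)) * ∏ j, gibbs (tilt i H t) (σ j) := fun ℓ => by
    rw [← Finset.mul_prod_erase _ _ (Finset.mem_univ ℓ), smul_eq_mul]
    ring
  simp only [h, ← Finset.sum_mul, Finset.sum_sub_distrib, Finset.sum_const, Finset.card_univ,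
    Fintype.card_fin, nsmul_eq_mul]

theorem hasDerivAt_gibbsExp_tilt (K : (Fin n → Spin N) → ℝ) (t : ℝ) :
    HasDerivAt (fun t => gibbsExp (tilt i H t) K) (gibbsExp (tilt i H t) (Dop i K)) t := by
  rw [gibbsExp_Dop]
  refine (HasDerivAt.fun_sum fun σ _ =>
    (hasDerivAt_prod_gibbs_tilt i H σ t).const_mul (K σ)).congr_deriv ?_
  exact Finset.sum_congr rfl fun σ _ => by ring

end Tilt

section Series

open PowerSeries

variable {N p n : ℕ} (i : Fin p → Fin N) (F : (Fin n → Spin N) → ℝ) (H : Spin N → ℝ)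

theorem coeff_prod_one_add_C_mul_X (y : Fin n → ℝ) (k : ℕ) :
    coeff k (∏ ℓ, (1 + C (y ℓ) * X) : ℝ⟦X⟧) =
      ∑ T ∈ Finset.powersetCard k Finset.univ, ∏ ℓ ∈ T, y ℓ := by
  rw [Finset.prod_one_add, map_sum, Finset.powersetCard_eq_filter, Finset.sum_filter]
  refine Finset.sum_congr rfl fun T _ => ?_
  rw [Finset.prod_mul_distrib, Finset.prod_const, ← map_prod, coeff_C_mul, coeff_X_pow]
  simp [eq_comm]

theorem coeff_esymmSeries (k : ℕ) :
    coeff k (esymmSeries i F H) = gibbsExp H fun σ =>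
      F σ * ∑ T ∈ Finset.powersetCard k Finset.univ, ∏ ℓ ∈ T, spinProd (σ ℓ) i := by
  rw [esymmSeries, map_sum, gibbsExp]
  refine Finset.sum_congr rfl fun σ _ => ?_
  rw [coeff_C_mul, coeff_prod_one_add_C_mul_X]
  ring

theorem one_sub_X_sq_mul_derivative_prod {ι : Type*} (s : Finset ι) (y : ι → ℝ)
    (hy : ∀ ℓ, y ℓ * y ℓ = 1) :
    (1 - X ^ 2) * derivative ℝ (∏ ℓ ∈ s, (1 + C (y ℓ) * X)) =
      (∑ ℓ ∈ s, C (y ℓ) - (s.card : ℝ⟦X⟧) * X) * ∏ ℓ ∈ s, (1 + C (y ℓ) * X) := by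
  classical
  induction s using Finset.induction_on with
  | empty => simp
  | insert a s ha ih =>
    have hC : (C (y a) : ℝ⟦X⟧) * C (y a) = 1 := by rw [← map_mul, hy, map_one]
    rw [Finset.prod_insert ha, Finset.sum_insert ha, Finset.card_insert_of_notMem ha]
    simp only [Derivation.leibniz, map_add, Derivation.map_one_eq_zero, derivative_C,
      derivative_X, smul_eq_mul, mul_zero, add_zero, mul_one, zero_add]
    push_cast
    linear_combination (1 + C (y a) * X) * ih +
      (∏ ℓ ∈ s, (1 + C (y ℓ) * X)) * (-X) * hC

/-- The series `⟨F (∑ σ_i^ℓ) ∏ (1 + σ_i^ℓ X)⟩`. -/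
def magnetizedSeries : ℝ⟦X⟧ :=
  esymmSeries i (fun σ => (∑ ℓ, spinProd (σ ℓ) i) * F σ) H

theorem one_sub_X_sq_mul_derivative_esymmSeries :
    (1 - X ^ 2) * derivative ℝ (esymmSeries i F H) =
      magnetizedSeries i F H - (n : ℝ⟦X⟧) * X * esymmSeries i F H := by
  rw [magnetizedSeries, esymmSeries, esymmSeries, map_sum, Finset.mul_sum, Finset.mul_sum,
    ← Finset.sum_sub_distrib]
  refine Finset.sum_congr rfl fun σ _ => ?_
  have h := one_sub_X_sq_mul_derivative_prod Finset.univ (fun ℓ => spinProd (σ ℓ) i)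
    fun ℓ => spinProd_mul_self i (σ ℓ)
  rw [Finset.card_univ, Fintype.card_fin] at h
  simp only [Derivation.leibniz, derivative_C, smul_eq_mul, mul_zero, add_zero, map_mul, map_sum]
  linear_combination (C (F σ) * C (∏ ℓ, gibbs H (σ ℓ))) * h

theorem hasDerivAt_coeff_esymmSeries_tilt (k : ℕ) (t : ℝ) :
    HasDerivAt (fun t => coeff k (esymmSeries i F (tilt i H t)))
      (coeff k (magnetizedSeries i F (tilt i H t) -
        (n : ℝ⟦X⟧) * C (gibbsMean i (tilt i H t)) * esymmSeries i F (tilt i H t))) t := by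
  simp only [coeff_esymmSeries]
  refine (hasDerivAt_gibbsExp_tilt i H _ t).congr_deriv ?_
  rw [gibbsExp_Dop, map_sub, magnetizedSeries, coeff_esymmSeries,
    ← map_natCast (C : ℝ →+* ℝ⟦X⟧) n, ← map_mul, coeff_C_mul,
    coeff_esymmSeries, ← gibbsExp_const_mul]
  simp only [gibbsExp, ← Finset.sum_sub_distrib]
  exact Finset.sum_congr rfl fun σ _ => by ring

theorem one_sub_X_mul_derivative_mk_one_pow (n : ℕ) :
    (1 - X) * derivative ℝ (PowerSeries.mk 1 ^ n : ℝ⟦X⟧) =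
      (n : ℝ⟦X⟧) * PowerSeries.mk 1 ^ n := by
  have h := mk_one_mul_one_sub_eq_one ℝ
  have h' := congrArg (derivative ℝ) h
  simp only [Derivation.leibniz, map_sub, Derivation.map_one_eq_zero, derivative_X, smul_eq_mul,
    zero_sub] at h'
  have h1 : (1 - X) * derivative ℝ (PowerSeries.mk 1 : ℝ⟦X⟧) = PowerSeries.mk 1 := by
    linear_combination h'
  cases n with
  | zero => simp
  | succ n =>
    rw [derivative_pow, Nat.add_sub_cancel]
    linear_combination ((n + 1 : ℕ) : ℝ⟦X⟧) * PowerSeries.mk 1 ^ n * h1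

theorem derivative_rescale (a : ℝ) (K : ℝ⟦X⟧) :
    derivative ℝ (rescale a K) = C a * rescale a (derivative ℝ K) := by
  ext k
  simp only [coeff_derivative, coeff_rescale, coeff_C_mul]
  ring

theorem one_add_C_mul_X_mul_rescale (x : ℝ) (n : ℕ) :
    (1 + C x * X) * rescale (-x) (derivative ℝ (PowerSeries.mk 1 ^ n : ℝ⟦X⟧)) =
      (n : ℝ⟦X⟧) * rescale (-x) (PowerSeries.mk 1 ^ n) := by
  have h := congrArg (rescale (-x)) (one_sub_X_mul_derivative_mk_one_pow n)
  simp only [map_mul, map_sub, map_one, rescale_X, map_natCast, map_neg] at h ⊢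
  linear_combination h

theorem hasDerivAt_coeff_rescale {x : ℝ → ℝ} {x' t : ℝ} (hx : HasDerivAt x x' t) (K : ℝ⟦X⟧)
    (k : ℕ) :
    HasDerivAt (fun t => coeff k (rescale (-x t) K))
      (coeff k (-C x' * X * rescale (-x t) (derivative ℝ K))) t := by
  simp only [coeff_rescale]
  refine ((hx.fun_neg.fun_pow k).mul_const (coeff k K)).congr_deriv ?_
  simp only [← map_neg, mul_assoc, coeff_C_mul]
  cases k with
  | zero => simp
  | succ k =>
    rw [coeff_succ_X_mul, coeff_rescale, coeff_derivative]
    push_cast [Nat.add_sub_cancel]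
    ring

theorem hasDerivAt_coeff_mul {Φ Ψ : ℝ → ℝ⟦X⟧} {Φ' Ψ' : ℝ⟦X⟧} {t : ℝ}
    (hΦ : ∀ k, HasDerivAt (fun t => coeff k (Φ t)) (coeff k Φ') t)
    (hΨ : ∀ k, HasDerivAt (fun t => coeff k (Ψ t)) (coeff k Ψ') t) (k : ℕ) :
    HasDerivAt (fun t => coeff k (Φ t * Ψ t)) (coeff k (Φ' * Ψ t + Φ t * Ψ')) t := by
  simp only [map_add, coeff_mul, ← Finset.sum_add_distrib]
  exact HasDerivAt.fun_sum fun q _ => (hΦ q.1).mul (hΨ q.2)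

/-- Tilting the Hamiltonian acts on the series `replicaSeries` as the operator
`(1 - X²) d/dX`. -/
theorem hasDerivAt_coeff_replicaSeries_tilt (k : ℕ) (t : ℝ) :
    HasDerivAt (fun t => coeff k (replicaSeries i F (tilt i H t)))
      (coeff k ((1 - X ^ 2) * derivative ℝ (replicaSeries i F (tilt i H t)))) t := by
  refine (hasDerivAt_coeff_mul (fun k => hasDerivAt_coeff_esymmSeries_tilt i F H k t)
    (fun k => hasDerivAt_coeff_rescale (hasDerivAt_gibbsMean_tilt i H t)
      (PowerSeries.mk 1 ^ n) k) k).congr_deriv ?_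
  congr 1
  have h1 := one_sub_X_sq_mul_derivative_esymmSeries i F (tilt i H t)
  have h2 := one_add_C_mul_X_mul_rescale (gibbsMean i (tilt i H t)) n
  rw [replicaSeries, Derivation.leibniz, derivative_rescale]
  have hC : (C (1 - gibbsMean i (tilt i H t) ^ 2) : ℝ⟦X⟧) =
      1 - C (gibbsMean i (tilt i H t)) ^ 2 := by simp
  rw [hC, map_neg, smul_eq_mul, smul_eq_mul]
  set x := (C (gibbsMean i (tilt i H t)) : ℝ⟦X⟧)
  linear_combination
    -rescale (-gibbsMean i (tilt i H t)) (PowerSeries.mk 1 ^ n) * h1 +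
      esymmSeries i F (tilt i H t) * (x - X) * h2

theorem coeff_one_sub_X_sq_mul_derivative (Φ : ℝ⟦X⟧) (k : ℕ) :
    coeff (k + 1) ((1 - X ^ 2) * derivative ℝ Φ) = (k + 2) * coeff (k + 2) Φ - k * coeff k Φ := by
  rw [sub_mul, one_mul, map_sub, coeff_derivative, coeff_X_pow_mul']
  rcases k with _ | k
  · simp
    ring
  · simp only [if_true, show k + 1 + 1 - 2 = k by omega, coeff_derivative,
      show 2 ≤ k + 1 + 1 by omega]
    push_cast
    ring

theorem coeff_replicaSeries (hn : 1 ≤ n) (j : ℕ) :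
    coeff j (replicaSeries i F H) = ∑ k ∈ Finset.range (j + 1),
      (-1) ^ (j - k) * (Nat.choose (n + j - k - 1) (n - 1) : ℝ) *
        ∑ T ∈ Finset.powersetCard k (Finset.univ : Finset (Fin n)),
          gibbsMean i H ^ (j - k) *
            gibbsExp H fun σ => F σ * ∏ ℓ ∈ T, spinProd (σ ℓ) i := by
  obtain ⟨d, rfl⟩ : ∃ d, n = d + 1 := ⟨n - 1, by omega⟩
  rw [replicaSeries, coeff_mul, Finset.Nat.sum_antidiagonal_eq_sum_range_succ_mk]
  refine Finset.sum_congr rfl fun k hk => ?_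
  have hk : k ≤ j := Nat.lt_succ_iff.1 (Finset.mem_range.1 hk)
  rw [mk_one_pow_eq_mk_choose_add, coeff_rescale, coeff_mk, coeff_esymmSeries,
    show d + 1 + j - k - 1 = d + (j - k) by omega, Nat.add_sub_cancel, neg_pow]
  simp only [Finset.mul_sum, gibbsExp_sum, Finset.sum_mul]
  exact Finset.sum_congr rfl fun T _ => by ring

theorem gibbsExp_Sfun_mul (hn : 1 ≤ n) (m : ℕ) {j : ℤ} (hj : 1 ≤ j) (hjm : j ≤ m) :
    gibbsExp H (fun σ : Fin (n + m) → Spin N =>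
      Sfun i n j (extendReplicas σ) * F fun ℓ => σ (ℓ.castAdd m)) =
      (j.toNat.factorial : ℝ) * coeff j.toNat (replicaSeries i F H) := by
  have hext : ∀ (σ : Fin (n + m) → Spin N) (ℓ : Fin n),
      extendReplicas σ ℓ = σ (ℓ.castAdd m) := fun σ ℓ => dif_pos (by omega)
  have hjm' : j.toNat ≤ m := by omega
  simp only [coeff_replicaSeries i F H hn, Sfun, if_pos hj, hext, mul_assoc, Finset.sum_mul,
    gibbsExp_const_mul, gibbsExp_sum]
  congr 1
  refine Finset.sum_congr rfl fun k hk => ?_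
  have hk : k ≤ j.toNat := Nat.lt_succ_iff.1 (Finset.mem_range.1 hk)
  congr 2
  refine Finset.sum_congr rfl fun T _ => ?_
  rw [← gibbsExp_mul_prod_Ico i H _ m (j.toNat - k) (by omega),
    show n + j.toNat - k = n + (j.toNat - k) by omega]
  congr 1
  funext σ
  ring

/-- The common value of the Gibbs expectations of `Sfun i n j * F`, for integer `j`. -/
def replicaMoment (j : ℤ) : ℝ :=
  if 1 ≤ j then (j.toNat.factorial : ℝ) * coeff j.toNat (replicaSeries i F H) else 0

theorem gibbsExp_Sfun_mul_eq_replicaMoment (hn : 1 ≤ n) (m : ℕ) {j : ℤ} (hjm : j ≤ m) :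
    gibbsExp H (fun σ : Fin (n + m) → Spin N =>
      Sfun i n j (extendReplicas σ) * F fun ℓ => σ (ℓ.castAdd m)) = replicaMoment i F H j := by
  by_cases hj : 1 ≤ j
  · rw [gibbsExp_Sfun_mul i F H hn m hj hjm, replicaMoment, if_pos hj]
  · simp [replicaMoment, Sfun, hj, gibbsExp]

theorem hasDerivAt_replicaMoment_tilt {j : ℤ} (hj : j ≠ 0) (t : ℝ) :
    HasDerivAt (fun t => replicaMoment i F (tilt i H t) j)
      (replicaMoment i F (tilt i H t) (j + 1) -
        j * (j - 1) * replicaMoment i F (tilt i H t) (j - 1)) t := by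
  by_cases h : 1 ≤ j
  · obtain ⟨k, rfl⟩ : ∃ k : ℕ, j = k + 1 := ⟨(j - 1).toNat, by omega⟩
    have e0 : ((k : ℤ) + 1).toNat = k + 1 := by omega
    have e1 : ((k : ℤ) + 1 + 1).toNat = k + 2 := by omega
    simp only [replicaMoment, if_pos h, e0, e1, if_pos (show (1 : ℤ) ≤ k + 1 + 1 by omega),
      add_sub_cancel_right, Int.toNat_natCast]
    refine ((hasDerivAt_coeff_replicaSeries_tilt i F H (k + 1) t).const_mul _).congr_deriv ?_
    rw [coeff_one_sub_X_sq_mul_derivative]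
    rcases k with _ | k
    · simp
    · rw [if_pos (by push_cast; omega)]
      simp only [Nat.factorial_succ]
      push_cast
      ring
  · simp only [replicaMoment, h, show ¬ 1 ≤ j + 1 by omega, show ¬ 1 ≤ j - 1 by omega, if_false,
      mul_zero, sub_zero]
    exact hasDerivAt_const t 0

theorem gibbsExp_eq_coeff_zero_replicaSeries :
    gibbsExp H F = coeff 0 (replicaSeries i F H) := by
  have h : coeff 0 (esymmSeries i F H) = gibbsExp H F := by simp [coeff_esymmSeries]
  have h1 : constantCoeff (rescale (-gibbsMean i H) (PowerSeries.mk 1)) = 1 := by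
    rw [← coeff_zero_eq_constantCoeff_apply, coeff_rescale]
    simp
  rw [replicaSeries, map_pow, ← h]
  simp only [coeff_zero_eq_constantCoeff_apply, map_mul, map_pow, h1,
    one_pow, mul_one]

end Series

theorem Aarr_zero_right (m : ℕ) : Aarr m 0 = 0 := by
  cases m <;> simp [Aarr]

theorem Aarr_succ_succ (m a : ℕ) (hm : 1 ≤ m) :
    Aarr (m + 1) (a + 1) =
      -((m : ℤ) - 2 * a + 2) * ((m : ℤ) - 2 * a + 1) * Aarr m a + Aarr m (a + 1) := by
  obtain ⟨m, rfl⟩ : ∃ k, m = k + 1 := ⟨m - 1, by omega⟩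
  rw [Aarr]
  push_cast
  ring

theorem Aarr_eq_zero (m a : ℕ) (hm : 1 ≤ m) (h : (m : ℤ) - 2 * a + 2 ≤ 0) : Aarr m a = 0 := by
  induction m, hm using Nat.le_induction generalizing a with
  | base =>
    obtain ⟨a, rfl⟩ : ∃ k, a = k + 2 := ⟨a - 2, by omega⟩
    simp [Aarr]
  | succ m hm ih =>
    rcases a with _ | a
    · exact Aarr_zero_right _
    · rw [Aarr_succ_succ m a hm, ih (a + 1) (by push_cast at h ⊢; omega)]
      push_cast at h
      rcases (show (m : ℤ) - 2 * a + 2 ≤ 0 ∨ (m : ℤ) - 2 * a + 1 = 0 by omega) with h' | h'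
      · rw [ih a h']; ring
      · rw [h']; ring

section Expansion

variable {N p n : ℕ} (i : Fin p → Fin N) (F : (Fin n → Spin N) → ℝ)

theorem gibbsExp_DopIter_eq_sum (m : ℕ) (hm : 1 ≤ m) (H : Spin N → ℝ) (t : ℝ) :
    gibbsExp (tilt i H t) (DopIter i m F) = ∑ a ∈ Finset.range (m + 2),
      (Aarr m a : ℝ) * replicaMoment i F (tilt i H t) ((m : ℤ) - 2 * a + 2) := by
  induction m, hm using Nat.le_induction generalizing t with
  | base =>
    have h := hasDerivAt_gibbsExp_tilt i H F t
    simp only [gibbsExp_eq_coeff_zero_replicaSeries i F] at h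
    have h' := h.unique (hasDerivAt_coeff_replicaSeries_tilt i F H 0 t)
    simp only [DopIter]
    refine h'.trans ?_
    simp [Finset.sum_range_succ, Aarr, replicaMoment, sub_mul]
    rw [← PowerSeries.coeff_zero_eq_constantCoeff_apply, PowerSeries.coeff_derivative]
    simp
  | succ m hm ih =>
    have h := hasDerivAt_gibbsExp_tilt i H (DopIter i m F) t
    simp only [ih] at h
    have hd : HasDerivAt (fun t => ∑ a ∈ Finset.range (m + 2),
        (Aarr m a : ℝ) * replicaMoment i F (tilt i H t) ((m : ℤ) - 2 * a + 2))
        (∑ a ∈ Finset.range (m + 2), (Aarr m a : ℝ) *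
          (replicaMoment i F (tilt i H t) ((m : ℤ) + 1 - 2 * a + 2) -
            (((m : ℝ) - 2 * a + 2) * ((m : ℝ) - 2 * a + 1)) *
            replicaMoment i F (tilt i H t) ((m : ℤ) + 1 - 2 * (a + 1) + 2))) t := by
      refine HasDerivAt.fun_sum fun a _ => ?_
      by_cases hj : (m : ℤ) - 2 * a + 2 = 0
      · simp only [Aarr_eq_zero m a hm hj.le, Int.cast_zero, zero_mul]
        exact hasDerivAt_const t 0
      · refine ((hasDerivAt_replicaMoment_tilt i F H hj t).const_mul _).congr_deriv ?_
        rw [show (m : ℤ) - 2 * a + 2 + 1 = m + 1 - 2 * a + 2 by ring,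
          show (m : ℤ) - 2 * a + 2 - 1 = m + 1 - 2 * (a + 1) + 2 by ring]
        push_cast
        ring
    refine (h.unique hd).trans ?_
    simp only [mul_sub, Finset.sum_sub_distrib]
    rw [Finset.sum_range_succ' _ (m + 1 + 1), Aarr_zero_right, Int.cast_zero, zero_mul, add_zero]
    have hshift : ∑ a ∈ Finset.range (m + 2),
        (Aarr m a : ℝ) * replicaMoment i F (tilt i H t) ((m : ℤ) + 1 - 2 * a + 2) =
        ∑ a ∈ Finset.range (m + 2), (Aarr m (a + 1) : ℝ) *
          replicaMoment i F (tilt i H t) ((m : ℤ) + 1 - 2 * ((a + 1 : ℕ) : ℤ) + 2) := by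
      have h1 := Finset.sum_range_succ (fun a : ℕ =>
        (Aarr m a : ℝ) * replicaMoment i F (tilt i H t) ((m : ℤ) + 1 - 2 * a + 2)) (m + 2)
      rw [Finset.sum_range_succ', Aarr_zero_right,
        Aarr_eq_zero m (m + 2) hm (by push_cast; omega)] at h1
      simpa using h1.symm
    rw [hshift, ← Finset.sum_sub_distrib]
    refine Finset.sum_congr rfl fun a _ => ?_
    rw [Aarr_succ_succ m a hm]
    push_cast
    ring

end Expansion

/-- **Proposition 4.2**: for any Hamiltonian `H` on `Σ_N`, any `n, m ≥ 1`, `p ≥ 2`,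
`i ∈ {1,…,N}^p` and `F : Σ_N^n → [-1,1]`,
`⟨D_i^m F⟩_H = ∑_{a=1}^∞ A(m,a) ⟨S_i^{m-2a+2,n} F⟩_H`, the sum having only finitely many
nonzero terms (all Gibbs expectations are taken with `n + m` replicas; the term `a = 0`
vanishes since `A(m,0) = 0`). -/
theorem gibbsExp_DopIter_eq_tsum {N n p : ℕ} (hn : 1 ≤ n) (hp : 2 ≤ p) (i : Fin p → Fin N) (m : ℕ) (hm : 1 ≤ m)
    (H : Spin N → ℝ) (F : (Fin n → Spin N) → ℝ)
    (hF : ∀ σ, F σ ∈ Set.Icc (-1 : ℝ) 1) :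
    (Set.Finite {a : ℕ | (Aarr m a : ℝ) *
        gibbsExp H (fun σ : Fin (n + m) → Spin N =>
          Sfun i n ((m : ℤ) - 2 * a + 2) (extendReplicas σ) * F fun ℓ => σ ⟨ℓ, by omega⟩)
      ≠ 0}) ∧
    gibbsExp H (DopIter i m F)
      = ∑' a : ℕ, (Aarr m a : ℝ) *
          gibbsExp H (fun σ : Fin (n + m) → Spin N =>
            Sfun i n ((m : ℤ) - 2 * a + 2) (extendReplicas σ) * F fun ℓ => σ ⟨ℓ, by omega⟩) := by
  have hterm : ∀ a : ℕ, (Aarr m a : ℝ) *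
      gibbsExp H (fun σ : Fin (n + m) → Spin N =>
        Sfun i n ((m : ℤ) - 2 * a + 2) (extendReplicas σ) * F fun ℓ => σ ⟨ℓ, by omega⟩) =
      (Aarr m a : ℝ) * replicaMoment i F H ((m : ℤ) - 2 * a + 2) := fun a => by
    rcases a with _ | a
    · simp [Aarr_zero_right]
    · rw [← gibbsExp_Sfun_mul_eq_replicaMoment i F H hn m (by push_cast; omega)]
      rfl
  have hzero : ∀ a ∉ Finset.range (m + 2),
      (Aarr m a : ℝ) * replicaMoment i F H ((m : ℤ) - 2 * a + 2) = 0 := fun a ha => by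
    rw [Aarr_eq_zero m a hm (by have := Finset.mem_range.not.1 ha; omega), Int.cast_zero, zero_mul]
  have htilt : tilt i H 0 = H := funext fun σ => by simp [tilt]
  simp only [hterm]
  refine ⟨(Finset.range (m + 2)).finite_toSet.subset fun a ha => ?_, ?_⟩
  · by_contra h
    exact ha (hzero a h)
  · rw [tsum_eq_sum hzero]
    simpa only [htilt] using gibbsExp_DopIter_eq_sum i F m hm H 0
end
end

section
/- Let ξ be a real-valued random variable with Eξ = 0 and Eξ² = 1, and let f : ℝ → ℝ be three times continuously differentiable with bounded first, second and third derivatives. Then E[ξ f(ξ)] = E[f'(ξ)] + γ_ξ²(f''), where γ_ξ²(f'') := E[ ξ ∫₀^ξ (ξ−x) f''(x) dx ] − E[ ∫₀^ξ (ξ−x) f'''(x) dx ], and all the expectations appearing are well-defined. -/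
open MeasureTheory intervalIntegral

/-- Second-order Taylor formula at `0` with integral remainder. -/
theorem integral_sub_mul_deriv_deriv {g : ℝ → ℝ} (hg : ContDiff ℝ 2 g) (t : ℝ) :
    ∫ x in (0:ℝ)..t, (t - x) * deriv (deriv g) x = g t - g 0 - t * deriv g 0 := by
  have hg' : ContDiff ℝ 1 (deriv g) := hg.deriv' (n := 1)
  have hd : ∀ x, HasDerivAt (fun x => (t - x) * deriv g x + g x)
      ((t - x) * deriv (deriv g) x) x := fun x => by
    have h₁ := (hg.differentiable (by norm_num) x).hasDerivAt
    have h₂ := (hg'.differentiable (by norm_num) x).hasDerivAt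
    refine ((((hasDerivAt_id x).const_sub t).mul h₂).add h₁).congr_deriv ?_
    simp only [id]
    ring
  have hc : Continuous fun x => (t - x) * deriv (deriv g) x :=
    (continuous_const.sub continuous_id).mul (hg'.continuous_deriv le_rfl)
  rw [integral_eq_sub_of_hasDerivAt (fun x _ => hd x) (hc.intervalIntegrable _ _)]
  ring

/-- **Proposition 6.1** (approximate integration by parts with cutoffs): if `ξ` has zero mean
and unit variance and `f` is three times continuously differentiable with bounded first,
second and third derivatives, then `E[ξ f(ξ)] = E[f'(ξ)] + γ_ξ²(f'')`, where
`γ_ξ²(f'') = E[ξ ∫₀^ξ (ξ-x) f''(x) dx] - E[∫₀^ξ (ξ-x) f'''(x) dx]`, and all the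
expectations appearing are well-defined. -/
theorem approximate_integration_by_parts
    {Ω : Type*} [MeasurableSpace Ω] (P : Measure Ω) [IsProbabilityMeasure P]
    (ξ : Ω → ℝ) (hξm : Measurable ξ)
    (h1 : Integrable ξ P) (hmean : ∫ ω, ξ ω ∂P = 0)
    (h2 : Integrable (fun ω => ξ ω ^ 2) P) (hvar : ∫ ω, ξ ω ^ 2 ∂P = 1)
    (f : ℝ → ℝ) (hf : ContDiff ℝ 3 f)
    (C1 C2 C3 : ℝ)
    (hb1 : ∀ x, |deriv f x| ≤ C1)
    (hb2 : ∀ x, |iteratedDeriv 2 f x| ≤ C2)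
    (hb3 : ∀ x, |iteratedDeriv 3 f x| ≤ C3) :
    Integrable (fun ω => ξ ω * f (ξ ω)) P ∧
    Integrable (fun ω => deriv f (ξ ω)) P ∧
    Integrable (fun ω => ξ ω * ∫ x in (0:ℝ)..(ξ ω), (ξ ω - x) * iteratedDeriv 2 f x) P ∧
    Integrable (fun ω => ∫ x in (0:ℝ)..(ξ ω), (ξ ω - x) * iteratedDeriv 3 f x) P ∧
    (∫ ω, ξ ω * f (ξ ω) ∂P
      = (∫ ω, deriv f (ξ ω) ∂P)
        + ((∫ ω, (ξ ω * ∫ x in (0:ℝ)..(ξ ω), (ξ ω - x) * iteratedDeriv 2 f x) ∂P)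
            - ∫ ω, (∫ x in (0:ℝ)..(ξ ω), (ξ ω - x) * iteratedDeriv 3 f x) ∂P)) := by
  have hf' : ContDiff ℝ 2 (deriv f) := hf.deriv' (n := 2)
  have hf₂ : iteratedDeriv 2 f = deriv (deriv f) := by simp [iteratedDeriv_succ]
  have hf₃ : iteratedDeriv 3 f = deriv (deriv (deriv f)) := by simp [iteratedDeriv_succ]
  simp only [hf₂, hf₃, integral_sub_mul_deriv_deriv hf',
    integral_sub_mul_deriv_deriv (hf.of_le (by norm_num : (2 : WithTop ℕ∞) ≤ 3))]
  have hgrowth : ∀ x, |f x| ≤ |f 0| + C1 * |x| := fun x => by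
    have h := Convex.norm_image_sub_le_of_norm_deriv_le (f := f)
      (fun y _ => hf.differentiable (by norm_num) y) (fun y _ => hb1 y)
      convex_univ (Set.mem_univ 0) (Set.mem_univ x)
    simp only [Real.norm_eq_abs, sub_zero] at h
    linarith [abs_sub_abs_le_abs_sub (f x) (f 0)]
  have hI : Integrable (fun ω => ξ ω * f (ξ ω)) P := by
    refine ((h1.abs.const_mul |f 0|).add (h2.const_mul C1)).mono'
      (hξm.mul (hf.continuous.measurable.comp hξm)).aestronglyMeasurable
      (Filter.Eventually.of_forall fun ω => ?_)
    simp only [Real.norm_eq_abs, abs_mul, Pi.add_apply]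
    calc |ξ ω| * |f (ξ ω)| ≤ |ξ ω| * (|f 0| + C1 * |ξ ω|) := by
          gcongr
          exact hgrowth _
      _ = |f 0| * |ξ ω| + C1 * ξ ω ^ 2 := by
          rw [← sq_abs (ξ ω)]
          ring
  have hI' : Integrable (fun ω => deriv f (ξ ω)) P :=
    (integrable_const C1).mono'
      (hf'.continuous.measurable.comp hξm).aestronglyMeasurable
      (Filter.Eventually.of_forall fun ω => hb1 _)
  have hlin : Integrable (fun ω => ξ ω * f 0) P := h1.mul_const _
  have hsq : Integrable (fun ω => ξ ω ^ 2 * deriv f 0) P := h2.mul_const _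
  have hlin' : Integrable (fun ω => ξ ω * deriv (deriv f) 0) P := h1.mul_const _
  have hexpand : (fun ω => ξ ω * (f (ξ ω) - f 0 - ξ ω * deriv f 0)) =
      fun ω => ξ ω * f (ξ ω) - ξ ω * f 0 - ξ ω ^ 2 * deriv f 0 := by
    funext ω
    ring
  have hI'c : Integrable (fun ω => deriv f (ξ ω) - deriv f 0) P :=
    hI'.sub (integrable_const _)
  have hIc : Integrable (fun ω => ξ ω * f (ξ ω) - ξ ω * f 0) P := hI.sub hlin
  refine ⟨hI, hI', ?_, hI'c.sub hlin', ?_⟩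
  · rw [hexpand]
    exact hIc.sub hsq
  · rw [hexpand, integral_sub hIc hsq, integral_sub hI hlin,
      integral_sub hI'c hlin', integral_sub hI' (integrable_const _),
      MeasureTheory.integral_mul_const, MeasureTheory.integral_mul_const,
      MeasureTheory.integral_mul_const, hmean, hvar]
    simp
end

section
/- Let f : ℝ → ℝ be twice continuously differentiable with bounded first and second derivatives. Then for every real number ξ, | ξ ∫₀^ξ (ξ−x) f''(x) dx | ≤ |ξ| ∫₀^{|ξ|} min{ 2‖f'‖_∞, ‖f''‖_∞ · x } dx, where ‖·‖_∞ denotes the supremum norm. -/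
open intervalIntegral

/-- Taylor's formula with integral remainder: the first-order remainder as the integral of the
increment of the derivative. -/
theorem integral_sub_mul_eq_integral_sub {g g' : ℝ → ℝ} (hg : ∀ x, HasDerivAt g (g' x) x)
    (hg' : Continuous g') (ξ : ℝ) :
    ∫ x in (0:ℝ)..ξ, (ξ - x) * g' x = ∫ x in (0:ℝ)..ξ, (g x - g 0) := by
  have h := integral_mul_deriv_eq_deriv_mul (a := 0) (b := ξ) (u := fun x => ξ - x)
    (v := fun x => g x - g 0) (u' := fun _ => -1) (v' := g')
    (fun x _ => (hasDerivAt_id x).const_sub ξ) (fun x _ => (hg x).sub_const _)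
    intervalIntegrable_const (hg'.intervalIntegrable _ _)
  rw [h]
  simp only [sub_self, zero_mul, mul_zero, neg_one_mul, integral_neg, zero_sub, neg_neg, sub_zero]

/-- A pointwise bound by a continuous function of `|x|` bounds the oriented integral. -/
theorem abs_integral_le_integral_abs_endpoint {h k : ℝ → ℝ} (hk : Continuous k)
    (hhk : ∀ x, |h x| ≤ k |x|) (ξ : ℝ) :
    |∫ x in (0:ℝ)..ξ, h x| ≤ ∫ x in (0:ℝ)..|ξ|, k x := by
  rcases le_total 0 ξ with hξ | hξ
  · rw [abs_of_nonneg hξ]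
    rw [← Real.norm_eq_abs]
    refine norm_integral_le_of_norm_le hξ (.of_forall fun x hx => ?_) (hk.intervalIntegrable _ _)
    simpa [abs_of_pos hx.1] using hhk x
  · have hneg : ∫ x in (0:ℝ)..-ξ, h (-x) = ∫ x in ξ..0, h x := by simp
    rw [abs_of_nonpos hξ, integral_symm, abs_neg, ← hneg]
    rw [← Real.norm_eq_abs]
    refine norm_integral_le_of_norm_le (neg_nonneg.2 hξ) (.of_forall fun x hx => ?_)
      (hk.intervalIntegrable _ _)
    simpa [abs_of_pos hx.1] using hhk (-x)

/-- The cutoff bound (6.3): if `f` is twice continuously differentiable with bounded first and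
second derivatives, then for every real `ξ`,
`|ξ ∫₀^ξ (ξ-x) f''(x) dx| ≤ |ξ| ∫₀^{|ξ|} min{2‖f'‖_∞, ‖f''‖_∞ x} dx`. -/
theorem cutoff_bound (f : ℝ → ℝ) (hf : ContDiff ℝ 2 f)
    (hb1 : BddAbove (Set.range fun x => |deriv f x|))
    (hb2 : BddAbove (Set.range fun x => |iteratedDeriv 2 f x|))
    (ξ : ℝ) :
    |ξ * ∫ x in (0:ℝ)..ξ, (ξ - x) * iteratedDeriv 2 f x|
      ≤ |ξ| * ∫ x in (0:ℝ)..|ξ|,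
          min (2 * ⨆ y, |deriv f y|) ((⨆ y, |iteratedDeriv 2 f y|) * x) := by
  have hf' : ContDiff ℝ 1 (deriv f) := ((contDiff_succ_iff_deriv (n := 1)).1 hf).2.2
  have h2 : iteratedDeriv 2 f = deriv (deriv f) := by
    rw [iteratedDeriv_succ, iteratedDeriv_one]
  rw [h2] at hb2 ⊢
  have hd : Differentiable ℝ (deriv f) := hf'.differentiable one_ne_zero
  rw [integral_sub_mul_eq_integral_sub (fun x => (hd x).hasDerivAt)
    (hf'.continuous_deriv le_rfl), abs_mul]
  refine mul_le_mul_of_nonneg_left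
    (abs_integral_le_integral_abs_endpoint
      (continuous_const.min (continuous_const.mul continuous_id))
      (fun x => le_min ?_ ?_) ξ) (abs_nonneg ξ)
  · have h1 := abs_sub (deriv f x) (deriv f 0)
    linarith [le_ciSup hb1 x, le_ciSup hb1 0]
  · simpa using convex_univ.norm_image_sub_le_of_norm_deriv_le (fun y _ => hd y)
      (fun y _ => le_ciSup hb2 y) (Set.mem_univ 0) (Set.mem_univ x)
end
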